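/- Let G be a simple graph on [0,n] and F ⊆ E(G\0), and suppose the flow polytope F_{H_G}(b_G^F) is nonempty. For I ⊆ [n], define z_I^F = min { Σ_{i∈I} f(i,t) : f a flow on H_G with netflow b_G^F }. Let S_F = { ψ(f) : f an integral flow on H_G with netflow b_G^F } ⊆ ℤ^n. Then the convex hull of S_F equals the generalized permutahedron P = { x ∈ ℝ^n : Σ_{i∈I} x_i ≥ z_I^F for every proper subset I of [n], and Σ_{i=1}^{n} x_i = z_{[n]}^F }; moreover every integer point of P lies in S_F. -/

import Mathlib

noncomputable section

open Finset

/-- The flow polytope of a directed graph with edge index set `ι`, edges `e` going from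
`src e` to `tgt e`, and netflow vector `a`. -/
def flowPolytope {V ι : Type*} [Fintype ι] [DecidableEq V]
    (src tgt : ι → V) (a : V → ℝ) : Set (ι → ℝ) :=
  {f | (∀ e, 0 ≤ f e) ∧
    ∀ v, (∑ e, if src e = v then f e else 0) - (∑ e, if tgt e = v then f e else 0) = a v}

/-- `E(G\0)`: the edges of `G` not incident to the vertex `0`. -/
def EG0 (n : ℕ) (G : Finset (Fin (n + 1) × Fin (n + 1))) :
    Finset (Fin (n + 1) × Fin (n + 1)) :=
  G.filter fun e => (e.1 : ℕ) ≠ 0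

/-- Source map of the graph `H_G` on the vertex set `[n] ∪ {t}` (modeled as
`Option (Fin (n+1))` with `none = t`; the vertex `some 0` is unused): the edges are the
edges `(j,i)` of `G` with `1 ≤ j < i ≤ n` together with one edge `(j,t)` for each
`j ∈ [n]`. -/
def srcH (n : ℕ) (G : Finset (Fin (n + 1) × Fin (n + 1))) :
    (↥(EG0 n G) ⊕ Fin n) → Option (Fin (n + 1))
  | Sum.inl e => some e.1.1
  | Sum.inr i => some i.succ

/-- Target map of `H_G`. -/
def tgtH (n : ℕ) (G : Finset (Fin (n + 1) × Fin (n + 1))) :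
    (↥(EG0 n G) ⊕ Fin n) → Option (Fin (n + 1))
  | Sum.inl e => some e.1.2
  | Sum.inr _ => none

/-- `indeg_G(v)`: number of edges of `G` ending at `v`. -/
def indeg (n : ℕ) (G : Finset (Fin (n + 1) × Fin (n + 1))) (v : Fin (n + 1)) : ℕ :=
  (G.filter fun e => e.2 = v).card

/-- `outdeg_F(v)`: number of edges of `F` starting at `v`. -/
def outdeg (n : ℕ) (F : Finset (Fin (n + 1) × Fin (n + 1))) (v : Fin (n + 1)) : ℕ :=
  (F.filter fun e => e.1 = v).card

/-- The netflow vector `b_G^F = (indeg_G(1) − outdeg_F(1), …, indeg_G(n) − outdeg_F(n),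
−#E(G\F))` on the vertices of `H_G`. -/
def bGF (n : ℕ) (G F : Finset (Fin (n + 1) × Fin (n + 1))) : Option (Fin (n + 1)) → ℝ
  | none => -((G.card : ℝ) - (F.card : ℝ))
  | some v => if v = 0 then 0 else (indeg n G v : ℝ) - (outdeg n F v : ℝ)

/-- `z_I^F = min { ∑_{i∈I} f(i,t) : f a flow on H_G with netflow b_G^F }`. -/
def zI (n : ℕ) (G F : Finset (Fin (n + 1) × Fin (n + 1))) (I : Finset (Fin n)) : ℝ :=
  sInf ((fun f => ∑ i ∈ I, f (Sum.inr i)) ''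
    flowPolytope (srcH n G) (tgtH n G) (bGF n G F))


/-- `S_F = ψ(integral flows on H_G with netflow b_G^F) ⊆ ℝ^n`, where
`ψ(f) = (f(1,t),…,f(n,t))`. -/
def ldSet (n : ℕ) (G F : Finset (Fin (n + 1) × Fin (n + 1))) : Set (Fin n → ℝ) :=
  {x | ∃ f ∈ flowPolytope (srcH n G) (tgtH n G) (bGF n G F),
    (∀ e, ∃ z : ℤ, f e = (z : ℝ)) ∧ x = fun i => f (Sum.inr i)}

section FlowPolytope

variable {V ι : Type*} [Fintype ι] [DecidableEq V]

/-- The total netflow out of a set of vertices, as a sum over edges. -/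
lemma sum_netflow_eq (src tgt : ι → V) (f : ι → ℝ) (R : Finset V) :
    ∑ v ∈ R, ((∑ e, if src e = v then f e else 0) - (∑ e, if tgt e = v then f e else 0)) =
      ∑ e, ((if src e ∈ R then f e else 0) - (if tgt e ∈ R then f e else 0)) := by
  rw [Finset.sum_sub_distrib, Finset.sum_comm, Finset.sum_comm (s := R), Finset.sum_sub_distrib]
  simp

lemma convex_flowPolytope (src tgt : ι → V) (a : V → ℝ) :
    Convex ℝ (flowPolytope src tgt a) := by
  rintro f ⟨hf0, hf⟩ g ⟨hg0, hg⟩ s t hs ht hst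
  refine ⟨fun e => add_nonneg (mul_nonneg hs (hf0 e)) (mul_nonneg ht (hg0 e)), fun v => ?_⟩
  have h1 : ∀ w : ι → V, (∑ e, if w e = v then (s • f + t • g) e else 0) =
      s * (∑ e, if w e = v then f e else 0) + t * ∑ e, if w e = v then g e else 0 := by
    intro w
    rw [Finset.mul_sum, Finset.mul_sum, ← Finset.sum_add_distrib]
    refine Finset.sum_congr rfl fun e _ => ?_
    split_ifs <;> simp
  rw [h1, h1]
  linear_combination s * hf v + t * hg v + a v * hst

/-- The netflow of an edge weighting, as a linear map. -/
def netflow (src tgt : ι → V) : (ι → ℝ) →ₗ[ℝ] (V → ℝ) :=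
  Fintype.linearCombination ℝ fun e => Pi.single (src e) (1 : ℝ) - Pi.single (tgt e) 1

lemma netflow_apply (src tgt : ι → V) (f : ι → ℝ) (v : V) :
    netflow src tgt f v =
      (∑ e, if src e = v then f e else 0) - (∑ e, if tgt e = v then f e else 0) := by
  rw [netflow, Fintype.linearCombination_apply, Finset.sum_apply, ← Finset.sum_sub_distrib]
  refine Finset.sum_congr rfl fun e _ => ?_
  simp [Pi.single_apply, mul_sub, eq_comm]

lemma mem_flowPolytope_iff {src tgt : ι → V} {a : V → ℝ} {f : ι → ℝ} :
    f ∈ flowPolytope src tgt a ↔ (∀ e, 0 ≤ f e) ∧ netflow src tgt f = a := by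
  simp only [flowPolytope, Set.mem_ofPred_eq, funext_iff, netflow_apply]

lemma netflow_single [DecidableEq ι] (src tgt : ι → V) (e : ι) (ε : ℝ) :
    netflow src tgt (Pi.single e ε) =
      ε • (Pi.single (src e) (1 : ℝ) - Pi.single (tgt e) 1 : V → ℝ) := by
  simp [netflow, Fintype.linearCombination_apply_single]

lemma continuous_netflow (src tgt : ι → V) (v : V) :
    Continuous fun f : ι → ℝ => netflow src tgt f v := by
  simp only [netflow_apply]
  refine .sub ?_ ?_ <;>
  · refine continuous_finsetSum _ fun e _ => ?_
    split_ifs <;> fun_prop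

/-- In an acyclic graph, a nonnegative weighting is bounded in terms of its netflow. -/
lemma sum_le_of_potential [Fintype V] {src tgt : ι → V} {p : V → ℝ}
    (hp : ∀ e, p (src e) + 1 ≤ p (tgt e)) {g : ι → ℝ} (hg : ∀ e, 0 ≤ g e) :
    ∑ e, g e ≤ ∑ v, |p v| * |netflow src tgt g v| := by
  have h1 : ∑ v, -(p v) * netflow src tgt g v = ∑ e, (p (tgt e) - p (src e)) * g e := by
    simp only [netflow_apply, mul_sub, Finset.mul_sum, Finset.sum_sub_distrib]
    rw [Finset.sum_comm, Finset.sum_comm (s := (Finset.univ : Finset V))]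
    simp only [mul_ite, mul_zero, Finset.sum_ite_eq, Finset.mem_univ, if_true]
    rw [← Finset.sum_sub_distrib]
    exact Finset.sum_congr rfl fun e _ => by ring
  calc ∑ e, g e ≤ ∑ e, (p (tgt e) - p (src e)) * g e :=
        Finset.sum_le_sum fun e _ => by nlinarith [hp e, hg e]
    _ = ∑ v, -(p v) * netflow src tgt g v := h1.symm
    _ ≤ _ := Finset.sum_le_sum fun v _ => by
        rw [← abs_neg (p v), ← abs_mul]; exact le_abs_self _

/-- Among nonnegative weightings of an acyclic graph there is one whose netflow is closest
to a given vector. -/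
lemma exists_netflow_closest [Fintype V] {src tgt : ι → V} {p : V → ℝ}
    (hp : ∀ e, p (src e) + 1 ≤ p (tgt e)) (c : V → ℝ) :
    ∃ g : ι → ℝ, (∀ e, 0 ≤ g e) ∧ ∀ h : ι → ℝ, (∀ e, 0 ≤ h e) →
      ∑ v, (c v - netflow src tgt g v) ^ 2 ≤ ∑ v, (c v - netflow src tgt h v) ^ 2 := by
  set Φ : (ι → ℝ) → ℝ := fun g => ∑ v, (c v - netflow src tgt g v) ^ 2 with hΦ
  have hΦc : Continuous Φ := continuous_finsetSum _ fun v _ =>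
    (continuous_const.sub (continuous_netflow src tgt v)).pow 2
  set K : Set (ι → ℝ) := {g | (∀ e, 0 ≤ g e) ∧ Φ g ≤ Φ 0} with hK
  have hclosed : IsClosed K := by
    refine IsClosed.inter ?_ (isClosed_le hΦc continuous_const)
    exact isClosed_Ici (a := (0 : ι → ℝ))
  have hcompact : IsCompact K := by
    refine (isCompact_Icc (a := (0 : ι → ℝ))
      (b := fun _ => ∑ v, |p v| * (|c v| + (Φ 0 + 1)))).of_isClosed_subset hclosed ?_
    rintro g ⟨hg, hgΦ⟩
    refine ⟨hg, fun e => ?_⟩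
    refine (Finset.single_le_sum (fun e _ => hg e) (Finset.mem_univ e)).trans
      ((sum_le_of_potential hp hg).trans (Finset.sum_le_sum fun v _ => ?_))
    refine mul_le_mul_of_nonneg_left ?_ (abs_nonneg _)
    have h1 : (c v - netflow src tgt g v) ^ 2 ≤ Φ 0 :=
      (Finset.single_le_sum (f := fun v => (c v - netflow src tgt g v) ^ 2)
        (fun v _ => sq_nonneg _) (Finset.mem_univ v)).trans hgΦ
    have h2 : |c v - netflow src tgt g v| ≤ Φ 0 + 1 := by
      rw [abs_le]; constructor <;> nlinarith [sq_nonneg (c v - netflow src tgt g v + 1),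
        sq_nonneg (c v - netflow src tgt g v - 1)]
    have h3 := abs_sub_abs_le_abs_sub (netflow src tgt g v) (c v)
    rw [abs_sub_comm] at h3
    linarith
  obtain ⟨g, ⟨hg0, hgΦ⟩, hg⟩ := hcompact.exists_isMinOn
    ⟨0, fun _ => le_rfl, le_rfl⟩ hΦc.continuousOn
  refine ⟨g, hg0, fun h hh => ?_⟩
  by_cases hhΦ : Φ h ≤ Φ 0
  · exact hg ⟨hh, hhΦ⟩
  · exact hgΦ.trans (not_le.mp hhΦ).le

/-- Feasibility criterion for uncapacitated flows on an acyclic graph. -/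
theorem flowPolytope_nonempty [Fintype V] {src tgt : ι → V} {p : V → ℝ}
    (hp : ∀ e, p (src e) + 1 ≤ p (tgt e)) {c : V → ℝ} (hc : ∑ v, c v = 0)
    (hR : ∀ R : Finset V, (∀ e, src e ∈ R → tgt e ∈ R) → ∑ v ∈ R, c v ≤ 0) :
    (flowPolytope src tgt c).Nonempty := by
  classical
  obtain ⟨g, hg0, hg⟩ := exists_netflow_closest hp c
  have hne : ∀ e, src e ≠ tgt e := fun e h => by
    have := hp e
    rw [h] at this
    linarith
  set u : V → ℝ := fun v => c v - netflow src tgt g v with hu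
  have hstep : ∀ e ε, 0 ≤ g e + ε → 0 ≤ ε * (u (tgt e) - u (src e) + ε) := by
    intro e ε hε
    have h1 := hg (g + Pi.single e ε) fun e' => by
      by_cases h : e' = e
      · subst h; simpa using hε
      · simpa [h] using hg0 e'
    have h2 : ∀ v, (c v - netflow src tgt (g + Pi.single e ε) v) ^ 2 = u v ^ 2 +
        ((if src e = v then -2 * ε * u v + ε ^ 2 else 0) +
          (if tgt e = v then 2 * ε * u v + ε ^ 2 else 0)) := by
      intro v
      have := hne e
      simp only [map_add, netflow_single, Pi.add_apply, Pi.smul_apply, Pi.sub_apply,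
        Pi.single_apply, smul_eq_mul, hu]
      by_cases h3 : src e = v
      · subst h3
        simp [this, this.symm]; ring
      · by_cases h4 : tgt e = v
        · subst h4
          simp [this, this.symm]; ring
        · simp [h3, h4, Ne.symm h3, Ne.symm h4]
    simp only [h2, Finset.sum_add_distrib, Finset.sum_ite_eq, Finset.mem_univ, if_true] at h1
    nlinarith
  have hle : ∀ e, u (src e) ≤ u (tgt e) := by
    intro e
    by_contra! h
    have := hstep e ((u (src e) - u (tgt e)) / 2) (by linarith [hg0 e])
    nlinarith
  have hzero : ∀ e, u (src e) < u (tgt e) → g e = 0 := by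
    intro e h
    by_contra! h0
    have hpos : 0 < g e := lt_of_le_of_ne (hg0 e) h0.symm
    set ε := min (g e) ((u (tgt e) - u (src e)) / 2) with hε
    have h1 : 0 < ε := lt_min hpos (by linarith)
    have h2 := hstep e (-ε) (by linarith [min_le_left (g e) ((u (tgt e) - u (src e)) / 2)])
    have h3 : ε ≤ (u (tgt e) - u (src e)) / 2 := min_le_right _ _
    nlinarith
  have hsum : ∀ R : Finset V, ∑ v ∈ R, u v = ∑ v ∈ R, c v -
      ∑ e, ((if src e ∈ R then g e else 0) - (if tgt e ∈ R then g e else 0)) := by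
    intro R
    rw [← sum_netflow_eq, ← Finset.sum_sub_distrib]
    simp only [hu, netflow_apply]
  have hupos : ∀ v, u v ≤ 0 := by
    set R : Finset V := Finset.univ.filter fun v => 0 < u v with hRdef
    have h1 : ∑ v ∈ R, u v ≤ 0 := by
      have hcR : ∑ v ∈ R, c v ≤ 0 := by
        refine hR R fun e he => ?_
        simp only [hRdef, Finset.mem_filter, Finset.mem_univ, true_and] at he ⊢
        exact he.trans_le (hle e)
      have hnet : ∑ e, ((if src e ∈ R then g e else 0) - (if tgt e ∈ R then g e else 0)) = 0 := by
        refine Finset.sum_eq_zero fun e _ => ?_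
        simp only [hRdef, Finset.mem_filter, Finset.mem_univ, true_and]
        by_cases h2 : 0 < u (src e)
        · simp [h2, h2.trans_le (hle e)]
        · by_cases h3 : 0 < u (tgt e)
          · simp [hzero e ((not_lt.mp h2).trans_lt h3)]
          · simp [h2, h3]
      rw [hsum, hnet, sub_zero]
      exact hcR
    intro v
    by_contra! hv
    have : 0 < ∑ v ∈ R, u v :=
      Finset.sum_pos (fun v hv => (Finset.mem_filter.mp hv).2) ⟨v, by simp [hRdef, hv]⟩
    linarith
  have htot : ∑ v, u v = 0 := by
    rw [hsum, hc]; simp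
  have hu0 := (Finset.sum_eq_zero_iff_of_nonpos fun v _ => hupos v).mp htot
  exact ⟨g, mem_flowPolytope_iff.mpr
    ⟨hg0, funext fun v => (sub_eq_zero.mp (hu0 v (Finset.mem_univ v))).symm⟩⟩

/-- A nonempty edge set in which no vertex has degree one supports a nonzero
circulation. -/
lemma exists_circulation {src tgt : ι → V} {E : Finset ι}
    (hE : E.Nonempty)
    (hdeg : ∀ e ∈ E, ∀ v, src e = v ∨ tgt e = v → ∃ e' ∈ E, e' ≠ e ∧ (src e' = v ∨ tgt e' = v)) :
    ∃ d : ι → ℝ, d ≠ 0 ∧ (∀ e, e ∉ E → d e = 0) ∧ netflow src tgt d = 0 := by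
  classical
  set W : Finset V := E.image src ∪ E.image tgt with hW
  have hsW : ∀ e ∈ E, src e ∈ W := fun e he =>
    Finset.mem_union_left _ (Finset.mem_image_of_mem _ he)
  have htW : ∀ e ∈ E, tgt e ∈ W := fun e he =>
    Finset.mem_union_right _ (Finset.mem_image_of_mem _ he)
  have hcard : W.card ≤ E.card := by
    have h := Finset.sum_card_bipartiteAbove_eq_sum_card_bipartiteBelow
      (s := W) (t := E) (fun v e => src e = v ∨ tgt e = v)
    have h1 : ∀ v ∈ W, 2 ≤ (Finset.bipartiteAbove (fun v e => src e = v ∨ tgt e = v) E v).card := by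
      intro v hv
      obtain ⟨e, he, hev⟩ : ∃ e ∈ E, src e = v ∨ tgt e = v := by
        rcases Finset.mem_union.mp hv with h | h <;>
        obtain ⟨e, he, h⟩ := Finset.mem_image.mp h
        · exact ⟨e, he, .inl h⟩
        · exact ⟨e, he, .inr h⟩
      obtain ⟨e', he', hne', hev'⟩ := hdeg e he v hev
      exact Finset.one_lt_card.mpr ⟨e', by simp [Finset.bipartiteAbove, he', hev'],
        e, by simp [Finset.bipartiteAbove, he, hev], hne'⟩
    have h2 : ∀ e ∈ E, (Finset.bipartiteBelow (fun v e => src e = v ∨ tgt e = v) W e).card ≤ 2 := by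
      intro e _
      refine (Finset.card_le_card (t := {src e, tgt e}) fun v hv => ?_).trans Finset.card_le_two
      have := (Finset.mem_filter.mp hv).2
      simp only [Finset.mem_insert, Finset.mem_singleton]
      exact this.imp Eq.symm Eq.symm
    have h3 := Finset.card_nsmul_le_sum _ _ _ h1
    have h4 := Finset.sum_le_card_nsmul _ _ _ h2
    simp only [smul_eq_mul] at h3 h4
    omega
  set L : (E → ℝ) →ₗ[ℝ] (W → ℝ) := netflow (fun e : E => (⟨src e, hsW e e.2⟩ : W))
    (fun e : E => (⟨tgt e, htW e e.2⟩ : W)) with hL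
  have hninj : ¬ Function.Injective L := by
    intro hinj
    have h1 := LinearMap.finrank_le_finrank_of_injective hinj
    simp only [Module.finrank_fintype_fun_eq_card, Fintype.card_coe] at h1
    have hsurj := (LinearMap.injective_iff_surjective_of_finrank_eq_finrank (f := L)
      (by simpa using le_antisymm h1 hcard)).mp hinj
    obtain ⟨e, he⟩ := hE
    obtain ⟨y, hy⟩ := hsurj (Pi.single ⟨src e, hsW e he⟩ 1)
    have h2 : ∑ w, L y w = 0 := by
      simp only [hL, netflow_apply]
      rw [sum_netflow_eq]
      simp
    rw [hy] at h2
    simp at h2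
  rw [← LinearMap.ker_eq_bot, Submodule.eq_bot_iff] at hninj
  push Not at hninj
  obtain ⟨y, hy, hy0⟩ := hninj
  rw [LinearMap.mem_ker] at hy
  have hext : ∀ (w : ι → V) (v : V),
      (∑ e, if w e = v then (if h : e ∈ E then y ⟨e, h⟩ else 0) else 0) =
        ∑ e : E, if w e = v then y e else 0 := by
    intro w v
    rw [← Finset.sum_subset (Finset.subset_univ E) (fun e _ he => by simp [he]),
      ← Finset.sum_coe_sort]
    simp
  refine ⟨fun e => if h : e ∈ E then y ⟨e, h⟩ else 0, ?_, fun e he => by simp [he], ?_⟩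
  · intro h0
    refine hy0 (funext fun e => ?_)
    simpa using congrFun h0 e
  · funext v
    rw [netflow_apply, hext, hext]
    by_cases hv : v ∈ W
    · have := congrFun hy ⟨v, hv⟩
      rw [hL, netflow_apply] at this
      simpa [Subtype.ext_iff] using this
    · have h1 : ∀ e : E, src e ≠ v := fun e h => hv (h ▸ hsW e e.2)
      have h2 : ∀ e : E, tgt e ≠ v := fun e h => hv (h ▸ htW e e.2)
      simp [h1, h2]

/-- The edges on which a weighting is not integral. -/
def fractionalEdges (f : ι → ℝ) : Finset ι := by
  classical exact Finset.univ.filter fun e => ¬ ∃ z : ℤ, f e = z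

lemma mem_fractionalEdges {f : ι → ℝ} {e : ι} :
    e ∈ fractionalEdges f ↔ ¬ ∃ z : ℤ, f e = z := by
  simp [fractionalEdges]

/-- Moving from a nonnegative weighting in a direction supported on its fractional edges, one
reaches a nonnegative weighting with fewer fractional edges. -/
lemma exists_step {f d : ι → ℝ} (hf : ∀ e, 0 ≤ f e) (hd0 : d ≠ 0)
    (hd : ∀ e, e ∉ fractionalEdges f → d e = 0) :
    ∃ s : ℝ, 0 < s ∧ (∀ e, 0 ≤ (f + s • d) e) ∧
      (fractionalEdges (f + s • d)).card < (fractionalEdges f).card := by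
  classical
  set b : ι → ℝ := fun e => if 0 < d e then (⌈f e⌉ : ℝ) else (⌊f e⌋ : ℝ) with hb
  set τ : ι → ℝ := fun e => (b e - f e) / d e with hτ
  have hfrac : ∀ e, d e ≠ 0 → (⌊f e⌋ : ℝ) < f e ∧ f e < ⌈f e⌉ := by
    intro e he
    have h := mem_fractionalEdges.mp (not_imp_comm.mp (hd e) he)
    exact ⟨lt_of_le_of_ne (Int.floor_le _) fun h' => h ⟨_, h'.symm⟩,
      lt_of_le_of_ne (Int.le_ceil _) fun h' => h ⟨_, h'⟩⟩
  have hτpos : ∀ e, d e ≠ 0 → 0 < τ e := by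
    intro e he
    obtain ⟨h1, h2⟩ := hfrac e he
    simp only [hτ, hb]
    rcases lt_or_gt_of_ne he with h | h
    · rw [if_neg (not_lt.mpr h.le)]
      exact div_pos_of_neg_of_neg (by linarith) h
    · rw [if_pos h]
      exact div_pos (by linarith) h
  obtain ⟨e₁, he₁⟩ := Function.ne_iff.mp hd0
  obtain ⟨e₀, he₀, hmin⟩ := Finset.exists_min_image (Finset.univ.filter fun e => d e ≠ 0) τ
    ⟨e₁, by simpa using he₁⟩
  simp only [Finset.mem_filter, Finset.mem_univ, true_and] at he₀ hmin
  refine ⟨τ e₀, hτpos e₀ he₀, fun e => ?_, Finset.card_lt_card ?_⟩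
  · simp only [Pi.add_apply, Pi.smul_apply, smul_eq_mul]
    rcases lt_trichotomy (d e) 0 with h | h | h
    · have h1 := mul_le_mul_of_nonpos_right (hmin e h.ne) h.le
      have h2 : τ e * d e = ⌊f e⌋ - f e := by
        simp only [hτ, hb, if_neg (not_lt.mpr h.le)]
        exact div_mul_cancel₀ _ h.ne
      have h3 : (0 : ℝ) ≤ ⌊f e⌋ := by exact_mod_cast Int.floor_nonneg.mpr (hf e)
      linarith
    · simpa [h] using hf e
    · have := mul_pos (hτpos e₀ he₀) h
      linarith [hf e]
  · refine (Finset.ssubset_iff_of_subset fun e he => ?_).mpr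
      ⟨e₀, not_imp_comm.mp (hd e₀) he₀, ?_⟩
    · by_contra hef
      rw [mem_fractionalEdges] at he hef
      simp [hd e (by rwa [mem_fractionalEdges])] at he
      exact hef (by simpa using he)
    · rw [mem_fractionalEdges, not_not]
      have h2 : τ e₀ * d e₀ = b e₀ - f e₀ := div_mul_cancel₀ _ he₀
      refine ⟨if 0 < d e₀ then ⌈f e₀⌉ else ⌊f e₀⌋, ?_⟩
      simp only [Pi.add_apply, Pi.smul_apply, smul_eq_mul, h2, hb]
      split_ifs <;> ring

/-- The fractional edges of a flow with integral netflow have no vertex of degree one. -/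
lemma exists_other_fractionalEdge {src tgt : ι → V} (hne : ∀ e, src e ≠ tgt e) {a : V → ℝ}
    (ha : ∀ v, ∃ z : ℤ, a v = z) {f : ι → ℝ} (hf : netflow src tgt f = a) :
    ∀ e ∈ fractionalEdges f, ∀ v, src e = v ∨ tgt e = v →
      ∃ e' ∈ fractionalEdges f, e' ≠ e ∧ (src e' = v ∨ tgt e' = v) := by
  classical
  intro e he v hev
  by_contra! hcon
  rw [mem_fractionalEdges] at he
  set S : AddSubgroup ℝ := (Int.castAddHom ℝ).range with hS
  have hmem : ∀ x : ℝ, x ∈ S ↔ ∃ z : ℤ, x = z := fun x =>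
    exists_congr fun z => eq_comm
  set t : ι → ℝ := fun e => (if src e = v then f e else 0) - (if tgt e = v then f e else 0) with ht
  have h1 : ∑ e', t e' = a v := by
    rw [← hf, netflow_apply, ← Finset.sum_sub_distrib]
  have h2 : ∀ e' ∈ Finset.univ.erase e, t e' ∈ S := by
    intro e' he'
    by_cases hv : src e' = v ∨ tgt e' = v
    · have h3 : f e' ∈ S := by
        by_contra h3
        rw [hmem, ← mem_fractionalEdges] at h3
        have := hcon e' h3 (Finset.ne_of_mem_erase he')
        tauto
      simp only [ht]
      split_ifs <;> simp [h3, S.zero_mem]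
    · push Not at hv
      simp [ht, hv.1, hv.2, S.zero_mem]
  have h3 : t e ∈ S := by
    rw [← Finset.add_sum_erase _ _ (Finset.mem_univ e)] at h1
    rw [eq_sub_of_add_eq h1]
    exact S.sub_mem ((hmem _).mpr (ha v)) (S.sum_mem h2)
  apply he
  rw [← hmem]
  rcases hev with h | h
  · have h' : tgt e ≠ v := fun h' => hne e (h.trans h'.symm)
    simpa [ht, h, h'] using h3
  · have h' : src e ≠ v := fun h' => hne e (h'.trans h.symm)
    simpa [ht, h, h'] using h3

/-- A flow with integral netflow on a loopless graph is a convex combination of integral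
flows. -/
theorem mem_convexHull_integral_flows {src tgt : ι → V} (hne : ∀ e, src e ≠ tgt e) {a : V → ℝ}
    (ha : ∀ v, ∃ z : ℤ, a v = z) {f : ι → ℝ} (hf : f ∈ flowPolytope src tgt a) :
    f ∈ convexHull ℝ {g | g ∈ flowPolytope src tgt a ∧ ∀ e, ∃ z : ℤ, g e = z} := by
  induction hk : (fractionalEdges f).card using Nat.strong_induction_on generalizing f with
  | _ k ih =>
    subst hk
    rcases (fractionalEdges f).eq_empty_or_nonempty with h0 | h0
    · refine subset_convexHull ℝ _ ⟨hf, fun e => ?_⟩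
      by_contra he
      rw [← mem_fractionalEdges, h0] at he
      simp at he
    · rw [mem_flowPolytope_iff] at hf
      obtain ⟨d, hd0, hd, hdnet⟩ :=
        exists_circulation h0 (exists_other_fractionalEdge hne ha hf.2)
      obtain ⟨s, hs, hs0, hscard⟩ := exists_step hf.1 hd0 hd
      obtain ⟨t, ht, ht0, htcard⟩ := exists_step hf.1 (neg_ne_zero.mpr hd0)
        (fun e he => by simp [hd e he])
      have h1 := ih _ hscard (mem_flowPolytope_iff.mpr ⟨hs0, by simp [hdnet, hf.2]⟩) rfl
      have h2 := ih _ htcard (mem_flowPolytope_iff.mpr ⟨ht0, by simp [hdnet, hf.2]⟩) rfl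
      have h3 := convex_convexHull ℝ _ h1 h2 (a := t / (s + t)) (b := s / (s + t))
        (by positivity) (by positivity) (by field_simp; ring)
      convert h3 using 1
      funext e
      simp only [Pi.add_apply, Pi.smul_apply, Pi.neg_apply, smul_eq_mul]
      field_simp
      ring

end FlowPolytope

section

variable {n : ℕ} {G F : Finset (Fin (n + 1) × Fin (n + 1))}

lemma sum_bGF_eq_zero (hne : (flowPolytope (srcH n G) (tgtH n G) (bGF n G F)).Nonempty) :
    bGF n G F none + ∑ v, bGF n G F (some v) = 0 := by
  obtain ⟨f, -, hf⟩ := hne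
  rw [← Fintype.sum_option]
  simp_rw [← hf]
  rw [sum_netflow_eq]
  simp

lemma sum_sink_eq {f : ↥(EG0 n G) ⊕ Fin n → ℝ}
    (hf : f ∈ flowPolytope (srcH n G) (tgtH n G) (bGF n G F)) :
    ∑ i, f (Sum.inr i) = -bGF n G F none := by
  rw [← hf.2 none]
  simp [srcH, tgtH]

lemma sum_bGF_le_sum_sink {f : ↥(EG0 n G) ⊕ Fin n → ℝ}
    (hf : f ∈ flowPolytope (srcH n G) (tgtH n G) (bGF n G F)) {R : Finset (Fin (n + 1))}
    (hR : ∀ e : ↥(EG0 n G), e.1.1 ∈ R → e.1.2 ∈ R) :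
    ∑ v ∈ R, bGF n G F (some v) ≤ ∑ i with i.succ ∈ R, f (Sum.inr i) := by
  have h := sum_netflow_eq (srcH n G) (tgtH n G) f (R.map Function.Embedding.some)
  simp_rw [hf.2] at h
  rw [Finset.sum_map, Fintype.sum_sum_type] at h
  simp only [Function.Embedding.some_apply] at h
  rw [h, Finset.sum_filter]
  refine add_le_of_nonpos_of_le (Finset.sum_nonpos fun e _ => ?_) (le_of_eq ?_)
  · have h1 := hf.1 (Sum.inl e)
    have h2 := hR e
    by_cases h3 : e.1.1 ∈ R
    · simp [srcH, tgtH, h3, h2 h3]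
    · simp only [srcH, tgtH, Finset.mem_map, Function.Embedding.some_apply, Option.some.injEq,
        exists_eq_right, h3, if_false]
      split_ifs <;> linarith
  · simp [srcH, tgtH]

lemma bddBelow_sink (I : Finset (Fin n)) :
    BddBelow ((fun f : ↥(EG0 n G) ⊕ Fin n → ℝ => ∑ i ∈ I, f (Sum.inr i)) ''
      flowPolytope (srcH n G) (tgtH n G) (bGF n G F)) := by
  refine ⟨0, ?_⟩
  rintro _ ⟨f, hf, rfl⟩
  exact Finset.sum_nonneg fun i _ => hf.1 _

lemma zI_nonneg (I : Finset (Fin n)) : 0 ≤ zI n G F I := by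
  refine Real.sInf_nonneg ?_
  rintro _ ⟨f, hf, rfl⟩
  exact Finset.sum_nonneg fun i _ => hf.1 _

lemma zI_univ (hne : (flowPolytope (srcH n G) (tgtH n G) (bGF n G F)).Nonempty) :
    zI n G F Finset.univ = -bGF n G F none := by
  rw [zI, Set.image_congr fun f hf => sum_sink_eq hf, hne.image_const, csInf_singleton]

lemma exists_int_bGF (v : Option (Fin (n + 1))) : ∃ z : ℤ, bGF n G F v = z := by
  cases v with
  | none => exact ⟨-((G.card : ℤ) - F.card), by simp [bGF]⟩
  | some v =>
    refine ⟨if v = 0 then 0 else (indeg n G v : ℤ) - outdeg n F v, ?_⟩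
    simp only [bGF]
    split_ifs <;> simp

/-- The netflow that remains on the edges of `G` not incident to `0` once the flow into the sink
is fixed to be `x`. -/
def innerNetflow (n : ℕ) (G F : Finset (Fin (n + 1) × Fin (n + 1))) (x : Fin n → ℝ) :
    Fin (n + 1) → ℝ :=
  fun v => bGF n G F (some v) - Fin.cons (α := fun _ => ℝ) 0 x v

lemma sumElim_mem_flowPolytope {x : Fin n → ℝ} (hx0 : ∀ i, 0 ≤ x i)
    (hx : ∑ i, x i = -bGF n G F none) {g : ↥(EG0 n G) → ℝ}
    (hg : g ∈ flowPolytope (fun e : ↥(EG0 n G) => e.1.1) (fun e => e.1.2)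
      (innerNetflow n G F x)) :
    Sum.elim g x ∈ flowPolytope (srcH n G) (tgtH n G) (bGF n G F) := by
  refine ⟨?_, ?_⟩
  · rintro (e | i)
    exacts [hg.1 e, hx0 i]
  · rintro (_ | v)
    · simp [srcH, tgtH, hx]
    · have h := hg.2 v
      simp only [innerNetflow] at h
      simp only [Fintype.sum_sum_type, srcH, tgtH, Sum.elim_inl, Sum.elim_inr, Option.some.injEq]
      have h1 : (∑ i : Fin n, if i.succ = v then x i else 0) =
          Fin.cons (α := fun _ => ℝ) 0 x v := by
        cases v using Fin.cases with
        | zero => simp [Fin.succ_ne_zero]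
        | succ j => simp
      rw [h1]
      simp only [reduceCtorEq, if_false, Finset.sum_const_zero, add_zero]
      linarith

lemma innerFlow_nonempty (hG : ∀ e ∈ G, e.1 < e.2)
    (hne : (flowPolytope (srcH n G) (tgtH n G) (bGF n G F)).Nonempty) {x : Fin n → ℝ}
    (hx : ∀ I, zI n G F I ≤ ∑ i ∈ I, x i) (hxu : ∑ i, x i = -bGF n G F none) :
    (flowPolytope (fun e : ↥(EG0 n G) => e.1.1) (fun e => e.1.2)
      (innerNetflow n G F x)).Nonempty := by
  refine flowPolytope_nonempty (p := fun v : Fin (n + 1) => ((v : ℕ) : ℝ)) (fun e => ?_) ?_ fun R hR => ?_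
  · exact_mod_cast Nat.succ_le_of_lt (hG e.1 (Finset.mem_filter.mp e.2).1)
  · simp only [innerNetflow, Finset.sum_sub_distrib, Fin.sum_cons, hxu]
    linarith [sum_bGF_eq_zero hne]
  · have h1 : ∑ v ∈ R, bGF n G F (some v) ≤ zI n G F {i | i.succ ∈ R} := by
      refine le_csInf (hne.image _) ?_
      rintro _ ⟨f, hf, rfl⟩
      exact sum_bGF_le_sum_sink hf hR
    have h2 : ∑ v ∈ R, Fin.cons (α := fun _ => ℝ) 0 x v = ∑ i with i.succ ∈ R, x i := by
      rw [Finset.sum_filter]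
      conv_lhs => rw [← Finset.univ_inter R, ← Finset.sum_ite_mem, Fin.sum_univ_succ]
      simp
    simp only [innerNetflow, Finset.sum_sub_distrib, h2]
    linarith [hx {i | i.succ ∈ R}]

end

/-- Theorem: `LD(G,F)` is a generalized permutahedron.  For a simple
graph `G` on `[0,n]` and `F ⊆ E(G\0)` with `F_{H_G}(b_G^F)` nonempty, the convex hull of
`S_F` equals the generalized permutahedron
`P = { x : ∑_{i∈I} x_i ≥ z_I^F for proper I ⊆ [n], ∑ x_i = z_{[n]}^F }`, and every
integer point of `P` lies in `S_F`. -/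
theorem ldSet_genPerm (n : ℕ) (G : Finset (Fin (n + 1) × Fin (n + 1)))
    (hG : ∀ e ∈ G, e.1 < e.2) (F : Finset (Fin (n + 1) × Fin (n + 1)))
    (hF : F ⊆ EG0 n G)
    (hne : (flowPolytope (srcH n G) (tgtH n G) (bGF n G F)).Nonempty) :
    convexHull ℝ (ldSet n G F) =
      {x : Fin n → ℝ |
        (∀ I : Finset (Fin n), I ≠ Finset.univ → zI n G F I ≤ ∑ i ∈ I, x i) ∧
        ∑ i, x i = zI n G F Finset.univ} ∧
    ∀ x : Fin n → ℝ,
      ((∀ I : Finset (Fin n), I ≠ Finset.univ → zI n G F I ≤ ∑ i ∈ I, x i) ∧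
        ∑ i, x i = zI n G F Finset.univ) →
      (∀ i, ∃ z : ℤ, x i = (z : ℝ)) → x ∈ ldSet n G F := by
  have hloop : ∀ e : ↥(EG0 n G) ⊕ Fin n, srcH n G e ≠ tgtH n G e := by
    rintro (e | i)
    · exact fun h => (hG e.1 (Finset.mem_filter.mp e.2).1).ne (Option.some.inj h)
    · exact Option.some_ne_none _
  set P : Set (Fin n → ℝ) := {x : Fin n → ℝ |
    (∀ I : Finset (Fin n), I ≠ Finset.univ → zI n G F I ≤ ∑ i ∈ I, x i) ∧
      ∑ i, x i = zI n G F Finset.univ} with hP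
  have hPle : ∀ x ∈ P, ∀ I, zI n G F I ≤ ∑ i ∈ I, x i := by
    intro x hx I
    by_cases hI : I = Finset.univ
    · exact hI ▸ hx.2.ge
    · exact hx.1 I hI
  have hPsum : ∀ x ∈ P, ∑ i, x i = -bGF n G F none := fun x hx => hx.2.trans (zI_univ hne)
  have hP0 : ∀ x ∈ P, ∀ i, 0 ≤ x i := fun x hx i => by
    simpa using (zI_nonneg {i}).trans (hPle x hx {i})
  refine ⟨?_, fun x hx hxint => ?_⟩
  · set ψ : (↥(EG0 n G) ⊕ Fin n → ℝ) →ₗ[ℝ] (Fin n → ℝ) := LinearMap.funLeft ℝ ℝ Sum.inr with hψ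
    have hld : ldSet n G F = ψ '' {f | f ∈ flowPolytope (srcH n G) (tgtH n G) (bGF n G F) ∧
        ∀ e, ∃ z : ℤ, f e = z} := by
      ext x
      constructor
      · rintro ⟨f, hf, hfint, rfl⟩
        exact ⟨f, ⟨hf, hfint⟩, rfl⟩
      · rintro ⟨f, ⟨hf, hfint⟩, rfl⟩
        exact ⟨f, hf, hfint, rfl⟩
    have hhull : convexHull ℝ {f | f ∈ flowPolytope (srcH n G) (tgtH n G) (bGF n G F) ∧
        ∀ e, ∃ z : ℤ, f e = z} = flowPolytope (srcH n G) (tgtH n G) (bGF n G F) :=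
      (convexHull_min (fun f hf => hf.1) (convex_flowPolytope _ _ _)).antisymm
        fun f hf => mem_convexHull_integral_flows hloop exists_int_bGF hf
    rw [hld, ← LinearMap.image_convexHull, hhull]
    ext x
    constructor
    · rintro ⟨f, hf, rfl⟩
      exact ⟨fun I _ => csInf_le (bddBelow_sink I) ⟨f, hf, rfl⟩,
        (sum_sink_eq hf).trans (zI_univ hne).symm⟩
    · intro hx
      obtain ⟨g, hg⟩ := innerFlow_nonempty hG hne (hPle x hx) (hPsum x hx)
      exact ⟨Sum.elim g x, sumElim_mem_flowPolytope (hP0 x hx) (hPsum x hx) hg, rfl⟩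
  · obtain ⟨g, hg⟩ := innerFlow_nonempty hG hne (hPle x hx) (hPsum x hx)
    have hfint : ∀ v, ∃ z : ℤ, innerNetflow n G F x v = z := by
      intro v
      obtain ⟨z, hz⟩ := exists_int_bGF (G := G) (F := F) (some v)
      cases v using Fin.cases with
      | zero => exact ⟨z, by simp [innerNetflow, hz]⟩
      | succ i =>
        obtain ⟨w, hw⟩ := hxint i
        exact ⟨z - w, by simp [innerNetflow, hz, hw]⟩
    obtain ⟨g', hg', hgint⟩ := convexHull_nonempty_iff.mp ⟨g, mem_convexHull_integral_flows
      (fun e => (hG e.1 (Finset.mem_filter.mp e.2).1).ne) hfint hg⟩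
    refine ⟨Sum.elim g' x, sumElim_mem_flowPolytope (hP0 x hx) (hPsum x hx) hg', ?_, rfl⟩
    rintro (e | i)
    exacts [hgint e, hxint i]
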